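/- arXiv:2011.02668 — 2 statements merged into one kernel-verified Lean document; each statement's English description precedes it below -/
import Mathlib

section
/- Let α and β be rational numbers with 0 < α < β ≤ 1/2. Then the ratio sin(πα)/sin(πβ) is a rational number if and only if α = 1/6 and β = 1/2. -/
/-- Kronecker-type lemma: an algebraic integer `(w⁻¹ - w) I / b` with `b ≥ 2` has norm one. -/
theorem sine_ratio_key (w z : ℂ) (n : ℕ) (hn : 0 < n) (hw : w ^ n = 1) (b : ℕ) (hb : 2 ≤ b)
    (hz : IsIntegral ℤ z) (hz0 : z ≠ 0) (h : (b : ℂ) * z = (w⁻¹ - w) * Complex.I) :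
    ‖z‖ = 1 := by
  have hwi : IsIntegral ℚ w := by
    refine .of_pow hn ?_
    rw [hw]; exact isIntegral_one
  have hIi : IsIntegral ℚ Complex.I := Complex.isIntegral_rat_I
  let K := IntermediateField.adjoin ℚ ({w, Complex.I} : Set ℂ)
  have : FiniteDimensional ℚ K := IntermediateField.finiteDimensional_adjoin (by
    rintro x (rfl | rfl)
    · exact hwi
    · exact hIi)
  have : NumberField K := ⟨⟩
  have hwK : w ∈ K := IntermediateField.subset_adjoin _ _ (by simp)
  have hIK : Complex.I ∈ K := IntermediateField.subset_adjoin _ _ (by simp)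
  have hb0 : (b : ℂ) ≠ 0 := by
    have : b ≠ 0 := by omega
    exact_mod_cast this
  have hzK : z ∈ K := by
    have : z = (w⁻¹ - w) * Complex.I * (b : ℂ)⁻¹ := by
      rw [← h]; field_simp
    rw [this]
    exact mul_mem (mul_mem (sub_mem (inv_mem hwK) hwK) hIK) (inv_mem (natCast_mem K b))
  let W : K := ⟨w, hwK⟩
  let J : K := ⟨Complex.I, hIK⟩
  let Z : K := ⟨z, hzK⟩
  have hZ : (b : K) * Z = (W⁻¹ - W) * J := by
    apply Subtype.ext
    simpa [W, J, Z] using h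
  have hW : W ^ n = 1 := Subtype.ext (by simpa [W] using hw)
  have hJ : J ^ 4 = 1 := Subtype.ext (by simp [J])
  have hZi : IsIntegral ℤ Z :=
    (isIntegral_algebraMap_iff (B := ℂ) (algebraMap K ℂ).injective).mp hz
  have hZ0 : Z ≠ 0 := fun h0 => hz0 (congrArg Subtype.val h0)
  obtain ⟨m, hm, hm1⟩ := NumberField.Embeddings.pow_eq_one_of_norm_le_one K ℂ hZ0 hZi (by
    intro φ
    have e1 : ‖φ W‖ = 1 := Complex.norm_eq_one_of_pow_eq_one (by rw [← map_pow, hW, map_one]) hn.ne'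
    have e2 : ‖φ J‖ = 1 :=
      Complex.norm_eq_one_of_pow_eq_one (n := 4) (by rw [← map_pow, hJ, map_one]) (by norm_num)
    have e3 := congrArg (fun t => ‖φ t‖) hZ
    simp only [map_mul, map_natCast, map_sub, map_inv₀, norm_mul, e2, mul_one,
      Complex.norm_natCast] at e3
    have e4 : ‖(φ W)⁻¹ - φ W‖ ≤ 2 := by
      refine (norm_sub_le _ _).trans ?_
      rw [norm_inv, e1]; norm_num
    have hb' : (2 : ℝ) ≤ b := by exact_mod_cast hb
    nlinarith [norm_nonneg (φ Z)])
  have : z ^ m = 1 := congrArg Subtype.val hm1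
  exact Complex.norm_eq_one_of_pow_eq_one this hm.ne'

/-- For rational numbers `0 < α < β ≤ 1/2`, the ratio `sin(πα)/sin(πβ)` is rational
if and only if `α = 1/6` and `β = 1/2`. -/
theorem sine_ratio_rational_iff (α β : ℚ) (h0 : 0 < α) (h1 : α < β) (h2 : β ≤ 1/2) :
    (Real.sin (Real.pi * α) / Real.sin (Real.pi * β)) ∈ Set.range ((↑) : ℚ → ℝ) ↔
      (α = 1/6 ∧ β = 1/2) := by
  have hpi := Real.pi_pos
  have hα : (0 : ℝ) < α := by exact_mod_cast h0
  have hαβ : (α : ℝ) < β := by exact_mod_cast h1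
  have hβ : (β : ℝ) ≤ 1 / 2 := by
    have : ((β : ℚ) : ℝ) ≤ ((1 / 2 : ℚ) : ℝ) := by exact_mod_cast h2
    simpa using this
  have inj : ∀ x y : ℚ, 0 < x → x ≤ 1/2 → 0 < y → y ≤ 1/2 →
      Real.sin (Real.pi * x) = Real.sin (Real.pi * y) → x = y := by
    intro x y hx hx' hy hy' he
    have a1 : (0 : ℝ) < x := by exact_mod_cast hx
    have a2 : (0 : ℝ) < y := by exact_mod_cast hy
    have a3 : (x : ℝ) ≤ 1 / 2 := by
      have : ((x : ℚ) : ℝ) ≤ ((1 / 2 : ℚ) : ℝ) := by exact_mod_cast hx'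
      simpa using this
    have a4 : (y : ℝ) ≤ 1 / 2 := by
      have : ((y : ℚ) : ℝ) ≤ ((1 / 2 : ℚ) : ℝ) := by exact_mod_cast hy'
      simpa using this
    have := Real.injOn_sin ⟨by nlinarith, by nlinarith⟩ ⟨by nlinarith, by nlinarith⟩ he
    have := mul_left_cancel₀ hpi.ne' this
    exact_mod_cast this
  have s6 : Real.sin (Real.pi * ((1 / 6 : ℚ) : ℝ)) = 1 / 2 := by
    rw [← Real.sin_pi_div_six]; congr 1; push_cast; ring
  have s2 : Real.sin (Real.pi * ((1 / 2 : ℚ) : ℝ)) = 1 := by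
    rw [← Real.sin_pi_div_two]; congr 1; push_cast; ring
  constructor
  swap
  · rintro ⟨rfl, rfl⟩
    exact ⟨1 / 2, by rw [s6, s2]; norm_num⟩
  rintro ⟨r, hr⟩
  have sα : 0 < Real.sin (Real.pi * α) := Real.sin_pos_of_pos_of_lt_pi (by positivity) (by nlinarith)
  have sβ : 0 < Real.sin (Real.pi * β) := Real.sin_pos_of_pos_of_lt_pi (by nlinarith) (by nlinarith)
  have slt : Real.sin (Real.pi * α) < Real.sin (Real.pi * β) :=
    Real.sin_lt_sin_of_lt_of_le_pi_div_two (by nlinarith) (by nlinarith) (by nlinarith)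
  have hr0 : 0 < r := by
    have : (0 : ℝ) < r := by rw [hr]; positivity
    exact_mod_cast this
  have hr1 : r < 1 := by
    have : (r : ℝ) < 1 := by rw [hr]; exact (div_lt_one sβ).2 slt
    exact_mod_cast this
  have hrd : 2 ≤ r.den := by
    by_contra hlt
    have hd1 : r.den = 1 := by have := r.den_pos; omega
    have e : (r.num : ℚ) = r := Rat.coe_int_num_of_den_eq_one hd1
    rw [← e] at hr0 hr1
    have b1 : 0 < r.num := by exact_mod_cast hr0
    have b2 : r.num < 1 := by exact_mod_cast hr1
    omega
  have hd0 : (r.den : ℝ) ≠ 0 := by exact_mod_cast r.den_nz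
  have hrel : (r.den : ℝ) * Real.sin (Real.pi * α) = r.num * Real.sin (Real.pi * β) := by
    have e : (r : ℝ) = r.num / r.den := by exact_mod_cast (Rat.num_div_den r).symm
    rw [e] at hr
    field_simp at hr
    linarith
  obtain ⟨u, v, huv⟩ : IsCoprime r.num (r.den : ℤ) := by
    rw [Int.isCoprime_iff_gcd_eq_one]; simpa [Int.gcd] using r.reduced
  have huv' : (u : ℝ) * r.num + v * r.den = 1 := by exact_mod_cast huv
  set z : ℝ := u * (2 * Real.sin (α * Real.pi)) + v * (2 * Real.sin (β * Real.pi)) with hzdef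
  have hzi : IsIntegral ℤ z :=
    ((isIntegral_algebraMap (x := u)).mul (Real.isIntegral_two_mul_sin_rat_mul_pi α)).add
      ((isIntegral_algebraMap (x := v)).mul (Real.isIntegral_two_mul_sin_rat_mul_pi β))
  have hzr : (r.den : ℝ) * z = 2 * Real.sin (Real.pi * β) := by
    rw [hzdef, mul_comm (α : ℝ), mul_comm (β : ℝ)]
    linear_combination 2 * u * hrel + 2 * Real.sin (Real.pi * β) * huv'
  have hdpos : (0 : ℝ) < r.den := by exact_mod_cast r.den_pos
  have hzpos : 0 < z := by
    by_contra hle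
    nlinarith
  have hn := sine_ratio_key (Complex.exp (β * Real.pi * Complex.I)) (z : ℂ) (2 * β.den)
    (by have := β.den_pos; omega) (Complex.exp_rat_mul_pi_mul_I_pow_two_mul_den β) r.den hrd
    (hzi.algebraMap (B := ℂ)) (by exact_mod_cast hzpos.ne') (by
      have e : ((r.den : ℝ) : ℂ) * (z : ℂ) = 2 * Complex.sin (Real.pi * β) := by
        have := congrArg (fun t : ℝ => (t : ℂ)) hzr
        simpa using this
      have e' : (r.den : ℂ) * (z : ℂ) = 2 * Complex.sin (Real.pi * β) := by simpa using e
      rw [e', ← Complex.exp_neg, mul_comm (Real.pi : ℂ), Complex.sin, ← neg_mul]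
      ring_nf)
  have hz1 : z = 1 := by
    rw [Complex.norm_real, Real.norm_of_nonneg hzpos.le] at hn
    exact hn
  have hrd' : (2 : ℝ) ≤ r.den := by exact_mod_cast hrd
  have sβ1 : Real.sin (Real.pi * β) = 1 := by
    have := Real.sin_le_one (Real.pi * β)
    rw [hz1] at hzr
    linarith
  have hβe : β = 1 / 2 := inj _ _ (h0.trans h1) h2 (by norm_num) le_rfl (sβ1.trans s2.symm)
  refine ⟨?_, hβe⟩
  rw [sβ1, div_one] at hr
  have hd2 : (r.den : ℝ) = 2 := by
    have := hzr
    rw [hz1, sβ1] at this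
    linarith
  have hniv := Real.isIntegral_two_mul_sin_rat_mul_pi α
  have sα2 : Real.sin (Real.pi * α) = 1 / 2 := by
    rw [sβ1, hd2] at hrel
    rw [sβ1] at slt
    have b1 : 0 < r.num := Rat.num_pos.2 hr0
    have b2 : r.num < 2 := by
      have : (r.num : ℝ) < 2 := by linarith
      exact_mod_cast this
    have b3 : r.num = 1 := by omega
    rw [b3] at hrel
    push_cast at hrel
    linarith
  exact inj _ _ h0 (h1.le.trans h2) (by norm_num) (by norm_num) (sα2.trans s6.symm)
end

section
/- Let n ≥ 8 be even, let r_n be the rotation matrix [[cos(π/n), −sin(π/n)], [sin(π/n), cos(π/n)]], let s_n = [[1, 2·cot(π/n)], [0, 1]], and let Γ_n be the subgroup of SL(2,ℝ) generated by {r_n², s_n, r_n·s_n·r_n⁻¹}. If v ∈ ℝ² \ {0} and the orbit Γ_n·v (under the standard linear action on ℝ²) is not dense in ℝ², then v is a nonzero real scalar multiple of some vector in Γ_n·(1,0) or of some vector in Γ_n·(cos(π/n), sin(π/n)). -/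
/-- The rotation matrix `r_n` by angle `π/n`, as an element of `SL(2,ℝ)`. -/
noncomputable def rotMat (n : ℕ) : Matrix.SpecialLinearGroup (Fin 2) ℝ :=
  ⟨!![Real.cos (Real.pi / n), -Real.sin (Real.pi / n);
      Real.sin (Real.pi / n), Real.cos (Real.pi / n)], by
    rw [Matrix.det_fin_two_of]; nlinarith [Real.sin_sq_add_cos_sq (Real.pi / n)]⟩

/-- The shear matrix `s_n = [[1, 2·cot(π/n)], [0, 1]]`, as an element of `SL(2,ℝ)`. -/
noncomputable def shearMat (n : ℕ) : Matrix.SpecialLinearGroup (Fin 2) ℝ :=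
  ⟨!![1, 2 * Real.cot (Real.pi / n); 0, 1], by simp [Matrix.det_fin_two_of]⟩

lemma aux_rot_zpow (n : ℕ) (k : ℤ) : ((rotMat n ^ k : Matrix.SpecialLinearGroup (Fin 2) ℝ) : Matrix (Fin 2) (Fin 2) ℝ)
    = !![Real.cos (k * (Real.pi / n)), -Real.sin (k * (Real.pi / n));
      Real.sin (k * (Real.pi / n)), Real.cos (k * (Real.pi / n))] := by
  induction k using Int.induction_on with
  | zero => simp [Matrix.one_fin_two]
  | succ i ih =>
    rw [zpow_add_one, Matrix.SpecialLinearGroup.coe_mul, ih]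
    push_cast
    rw [add_mul, one_mul, Real.cos_add, Real.sin_add]
    simp only [rotMat]
    rw [Matrix.mul_fin_two]
    congr! 3 <;> ring_nf
  | pred i ih =>
    rw [zpow_sub_one, Matrix.SpecialLinearGroup.coe_mul, ih, Matrix.SpecialLinearGroup.coe_inv]
    push_cast
    rw [sub_mul, one_mul, Real.cos_sub, Real.sin_sub]
    simp only [rotMat]
    rw [Matrix.adjugate_fin_two_of, Matrix.mul_fin_two]
    congr! 3 <;> ring_nf

lemma aux_shear_zpow (n : ℕ) (k : ℤ) : ((shearMat n ^ k : Matrix.SpecialLinearGroup (Fin 2) ℝ) : Matrix (Fin 2) (Fin 2) ℝ)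
    = !![1, k * (2 * Real.cot (Real.pi / n)); 0, 1] := by
  induction k using Int.induction_on with
  | zero => simp [Matrix.one_fin_two]
  | succ i ih =>
    rw [zpow_add_one, Matrix.SpecialLinearGroup.coe_mul, ih]
    push_cast
    simp only [shearMat]
    rw [Matrix.mul_fin_two]
    congr! 3 <;> ring_nf
  | pred i ih =>
    rw [zpow_sub_one, Matrix.SpecialLinearGroup.coe_mul, ih, Matrix.SpecialLinearGroup.coe_inv]
    push_cast
    simp only [shearMat]
    rw [Matrix.adjugate_fin_two_of, Matrix.mul_fin_two]
    congr! 3 <;> ring_nf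

/-- the group -/
noncomputable def auxG (n : ℕ) : Subgroup (Matrix.SpecialLinearGroup (Fin 2) ℝ) :=
  Subgroup.closure {rotMat n ^ 2, shearMat n, rotMat n * shearMat n * (rotMat n)⁻¹}

lemma aux_r2 (n : ℕ) (j : ℤ) : rotMat n ^ (2 * j) ∈ auxG n := by
  rw [zpow_mul]
  apply Subgroup.zpow_mem
  apply Subgroup.subset_closure
  left; norm_cast

lemma aux_conj (n : ℕ) (k m : ℤ) :
    rotMat n ^ k * shearMat n ^ m * rotMat n ^ (-k) ∈ auxG n := by
  rcases Int.even_or_odd' k with ⟨j, rfl | rfl⟩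
  · rw [← mul_neg]
    refine mul_mem (mul_mem (aux_r2 n j) (Subgroup.zpow_mem _ ?_ _)) (aux_r2 n (-j))
    exact Subgroup.subset_closure (by simp)
  · have : rotMat n ^ (2*j+1) * shearMat n ^ m * rotMat n ^ (-(2*j+1))
      = rotMat n ^ (2*j) * (rotMat n * shearMat n * (rotMat n)⁻¹)^m * rotMat n ^ (2*(-j)) := by
      rw [conj_zpow]
      group
    rw [this]
    refine mul_mem (mul_mem (aux_r2 n j) (Subgroup.zpow_mem _ ?_ _)) (aux_r2 n (-j))
    exact Subgroup.subset_closure (by simp)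

/-- action -/
noncomputable def auxA (A : Matrix.SpecialLinearGroup (Fin 2) ℝ) (v : Fin 2 → ℝ) : Fin 2 → ℝ :=
  Matrix.mulVec (A : Matrix (Fin 2) (Fin 2) ℝ) v

lemma auxA_mul (A B : Matrix.SpecialLinearGroup (Fin 2) ℝ) (v : Fin 2 → ℝ) :
    auxA (A * B) v = auxA A (auxA B v) := by
  unfold auxA
  rw [Matrix.SpecialLinearGroup.coe_mul, Matrix.mulVec_mulVec]

lemma auxA_one (v : Fin 2 → ℝ) : auxA 1 v = v := by simp [auxA]

lemma auxA_smul (A : Matrix.SpecialLinearGroup (Fin 2) ℝ) (c : ℝ) (v : Fin 2 → ℝ) :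
    auxA A (c • v) = c • auxA A v := by
  simp [auxA, Matrix.mulVec_smul]

lemma auxA_inv (A : Matrix.SpecialLinearGroup (Fin 2) ℝ) (v : Fin 2 → ℝ) :
    auxA A⁻¹ (auxA A v) = v := by
  rw [← auxA_mul]; simp [auxA_one]

lemma auxA_inv2 (A : Matrix.SpecialLinearGroup (Fin 2) ℝ) (v : Fin 2 → ℝ) :
    auxA A (auxA A⁻¹ v) = v := by
  rw [← auxA_mul]; simp [auxA_one]

lemma auxA_det (A : Matrix.SpecialLinearGroup (Fin 2) ℝ) (v w : Fin 2 → ℝ) :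
    auxA A v 0 * auxA A w 1 - auxA A v 1 * auxA A w 0 = v 0 * w 1 - v 1 * w 0 := by
  have h := A.det_coe
  rw [Matrix.det_fin_two] at h
  simp only [auxA, Matrix.mulVec, dotProduct, Fin.sum_univ_two]
  linear_combination (v 0 * w 1 - v 1 * w 0) * h

/-- squared norm -/
def auxq (v : Fin 2 → ℝ) : ℝ := v 0 ^ 2 + v 1 ^ 2

lemma auxA_sub (A : Matrix.SpecialLinearGroup (Fin 2) ℝ) (v w : Fin 2 → ℝ) :
    auxA A (v - w) = auxA A v - auxA A w := by
  simp [auxA, Matrix.mulVec_sub]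

lemma auxq_rot (n : ℕ) (k : ℤ) (v : Fin 2 → ℝ) : auxq (auxA (rotMat n ^ k) v) = auxq v := by
  simp only [auxq, auxA, aux_rot_zpow, Matrix.mulVec, dotProduct, Fin.sum_univ_two]
  simp
  linear_combination (v 0 ^ 2 + v 1 ^ 2) * Real.sin_sq_add_cos_sq (k * (Real.pi / n))

/-- direction of `r^k e1` -/
noncomputable def auxE (n : ℕ) (k : ℤ) : Fin 2 → ℝ := auxA (rotMat n ^ k) ![1, 0]

/-- being a multiple of a cusp vector -/
def auxCusp (n : ℕ) (v : Fin 2 → ℝ) : Prop :=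
  ∃ (c : ℝ) (A : Matrix.SpecialLinearGroup (Fin 2) ℝ), c ≠ 0 ∧ A ∈ auxG n ∧
    (v = c • auxA A (auxE n 0) ∨ v = c • auxA A (auxE n 1))

lemma auxE_zero (n : ℕ) : auxE n 0 = ![1, 0] := by simp [auxE, auxA_one]

lemma auxE_one (n : ℕ) : auxE n 1 = ![Real.cos (Real.pi / n), Real.sin (Real.pi / n)] := by
  simp only [auxE, auxA, aux_rot_zpow]
  ext i; fin_cases i <;> simp [Matrix.mulVec, dotProduct, Fin.sum_univ_two]

lemma auxCusp_of (n : ℕ) (v : Fin 2 → ℝ) (A : Matrix.SpecialLinearGroup (Fin 2) ℝ)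
    (hA : A ∈ auxG n) (h : auxCusp n (auxA A v)) : auxCusp n v := by
  obtain ⟨c, B, hc, hB, h⟩ := h
  refine ⟨c, A⁻¹ * B, hc, mul_mem (inv_mem hA) hB, ?_⟩
  refine h.imp (fun h => ?_) (fun h => ?_) <;>
  · rw [auxA_mul, ← auxA_smul, ← h, auxA_inv]

lemma auxA_ne (A : Matrix.SpecialLinearGroup (Fin 2) ℝ) (v : Fin 2 → ℝ) (hv : v ≠ 0) :
    auxA A v ≠ 0 := by
  intro h
  apply hv
  rw [← auxA_inv A v, h]; simp [auxA]

lemma auxCusp_axis (n : ℕ) (k : ℤ) (v : Fin 2 → ℝ) (hv : v ≠ 0)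
    (h : auxA (rotMat n ^ (-k)) v 1 = 0) : auxCusp n v := by
  set w := auxA (rotMat n ^ (-k)) v with hw
  have hw0 : w ≠ 0 := auxA_ne _ _ hv
  have hwe : w = w 0 • ![1, 0] := by
    ext i; fin_cases i <;> simp [h]
  have hc : w 0 ≠ 0 := by
    intro h0; apply hw0; rw [hwe, h0]; simp
  have hv' : v = w 0 • auxE n k := by
    rw [auxE, ← auxA_smul, ← hwe, hw, ← auxA_mul]; simp [auxA_one]
  rcases Int.even_or_odd' k with ⟨j, rfl | rfl⟩
  · refine ⟨w 0, rotMat n ^ (2*j), hc, aux_r2 n j, Or.inl ?_⟩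
    rw [hv', auxE_zero]; simp [auxE]
  · refine ⟨w 0, rotMat n ^ (2*j), hc, aux_r2 n j, Or.inr ?_⟩
    rw [auxE, ← auxA_mul, ← zpow_add]; exact hv'

/-- key approximation: move the first coordinate of `r^{-k} w` near `t` -/
lemma aux_move (n : ℕ) (hn : 8 ≤ n) (k : ℤ) (w : Fin 2 → ℝ) (t : ℝ)
    (hy : auxA (rotMat n ^ (-k)) w 1 ≠ 0) :
    ∃ A ∈ auxG n, auxq (auxA A w - t • auxE n k)
      ≤ auxA (rotMat n ^ (-k)) w 1 ^ 2 / Real.sin (Real.pi / n) ^ 2 := by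
  have hn' : (8:ℝ) ≤ n := by exact_mod_cast hn
  have hθ : 0 < Real.pi / n := by positivity
  have hθ2 : Real.pi / n < Real.pi / 2 := by
    apply div_lt_div_of_pos_left Real.pi_pos <;> linarith
  have hs : 0 < Real.sin (Real.pi / n) := Real.sin_pos_of_pos_of_lt_pi hθ (by linarith [Real.pi_pos])
  have hc : 0 < Real.cos (Real.pi / n) := Real.cos_pos_of_mem_Ioo ⟨by linarith, hθ2⟩
  set z := auxA (rotMat n ^ (-k)) w with hz
  set L := Real.cot (Real.pi / n) with hL
  have hLv : L = Real.cos (Real.pi / n) / Real.sin (Real.pi / n) := Real.cot_eq_cos_div_sin _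
  have hL0 : 0 < L := by rw [hLv]; positivity
  set m := round ((t - z 0) / (2 * L * z 1)) with hm
  refine ⟨_, aux_conj n k m, ?_⟩
  rw [auxA_mul, auxA_mul, ← hz, auxE, ← auxA_smul, ← auxA_sub, auxq_rot]
  have h2 := abs_sub_round ((t - z 0) / (2 * L * z 1))
  rw [← hm] at h2
  have h3 : (z 0 + m * (2 * L) * z 1 - t) = -(((t - z 0) / (2 * L * z 1)) - m) * (2 * L * z 1) := by
    field_simp; ring
  have h4 : (((t - z 0) / (2 * L * z 1)) - m)^2 ≤ 1/4 := by
    rw [← sq_abs]; nlinarith [abs_nonneg (((t - z 0) / (2 * L * z 1)) - m)]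
  have h5 : (z 0 + m * (2 * L) * z 1 - t)^2 ≤ L^2 * z 1 ^2 := by
    rw [h3]
    nlinarith [mul_le_mul_of_nonneg_right h4 (sq_nonneg (2 * L * z 1))]
  have h6 : z 1 ^ 2 / Real.sin (Real.pi / n) ^ 2 = L^2 * z 1 ^ 2 + z 1 ^ 2 := by
    rw [hLv]; field_simp; linear_combination - Real.sin_sq_add_cos_sq (Real.pi / n)
  rw [h6]
  have h7 : auxq (auxA (shearMat n ^ m) z - t • ![1, 0]) = (z 0 + m * (2 * L) * z 1 - t)^2 + z 1 ^ 2 := by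
    simp only [auxq, auxA, aux_shear_zpow]
    simp [Matrix.mulVec, dotProduct, Fin.sum_univ_two, hL]
  rw [h7]; linarith

lemma aux_contract (n : ℕ) (hn : 8 ≤ n) (v : Fin 2 → ℝ) (hv : v ≠ 0) (hc : ¬ auxCusp n v) :
    ∃ A ∈ auxG n, auxq (auxA A v) ≤ 1/2 * auxq v := by
  have hn' : (8:ℝ) ≤ n := by exact_mod_cast hn
  set θ := Real.pi / n with hθd
  have hθ : 0 < θ := by positivity
  have hθ2 : θ < Real.pi / 2 := by
    apply div_lt_div_of_pos_left Real.pi_pos <;> linarith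
  set zc : ℂ := ⟨v 0, v 1⟩ with hzc
  have hv0 : v 0 = ‖zc‖ * Real.cos zc.arg := by rw [Complex.norm_mul_cos_arg]
  have hv1 : v 1 = ‖zc‖ * Real.sin zc.arg := by rw [Complex.norm_mul_sin_arg]
  set φ := zc.arg
  set ρ := ‖zc‖
  set k := round (φ / θ) with hk
  have h1 := abs_sub_round (φ / θ)
  rw [← hk] at h1
  have h2 : |φ - k * θ| ≤ θ / 2 := by
    have : φ - k * θ = (φ / θ - k) * θ := by field_simp
    rw [this, abs_mul, abs_of_pos hθ]; nlinarith
  have hq : auxq v = ρ ^ 2 := by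
    rw [auxq, hv0, hv1]; linear_combination ρ^2 * Real.sin_sq_add_cos_sq φ
  have hy : auxA (rotMat n ^ (-k)) v 1 = ρ * Real.sin (φ - k * θ) := by
    simp only [auxA, aux_rot_zpow]
    simp [Matrix.mulVec, dotProduct, Fin.sum_univ_two]
    rw [← hθd, hv0, hv1, Real.sin_sub]; ring
  obtain ⟨A, hA, h⟩ := aux_move n hn k v 0 (fun h => hc (auxCusp_axis n k v hv h))
  refine ⟨A, hA, ?_⟩
  rw [zero_smul, sub_zero] at h
  refine h.trans ?_
  rw [hy, hq, ← hθd]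
  have hs2 : 0 < Real.sin (θ/2) := Real.sin_pos_of_pos_of_lt_pi (by linarith) (by linarith [Real.pi_pos])
  have h8 : Real.sin (φ - k * θ) ^ 2 ≤ Real.sin (θ/2)^2 := by
    rw [abs_le] at h2
    have e1 := Real.sin_le_sin_of_le_of_le_pi_div_two (x := φ - k*θ) (y := θ/2) (by linarith) (by linarith) h2.2
    have e2 := Real.sin_le_sin_of_le_of_le_pi_div_two (x := -(θ/2)) (y := φ - k*θ) (by linarith) (by linarith) h2.1
    rw [Real.sin_neg] at e2
    nlinarith
  have hsd : Real.sin θ = 2 * Real.sin (θ/2) * Real.cos (θ/2) := by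
    rw [← Real.sin_two_mul]; ring_nf
  have hcd : 1/2 ≤ Real.cos (θ/2)^2 := by
    rw [Real.cos_sq]
    have : 0 ≤ Real.cos (2 * (θ/2)) := Real.cos_nonneg_of_mem_Icc ⟨by linarith, by linarith⟩
    linarith
  have hsin : 2 * Real.sin (θ/2)^2 ≤ Real.sin θ ^ 2 := by
    rw [hsd]; nlinarith [mul_le_mul_of_nonneg_left hcd (sq_nonneg (Real.sin (θ/2)))]
  have hpos : 0 < Real.sin θ ^ 2 := by nlinarith
  rw [div_le_iff₀ hpos]
  nlinarith [mul_le_mul_of_nonneg_left (h8.trans (by linarith : _ ≤ Real.sin θ ^ 2 / 2)) (sq_nonneg ρ)]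

lemma aux_small (n : ℕ) (hn : 8 ≤ n) (v : Fin 2 → ℝ) (hv : v ≠ 0) (hc : ¬ auxCusp n v)
    (ε : ℝ) (hε : 0 < ε) : ∃ A ∈ auxG n, auxq (auxA A v) < ε := by
  have key : ∀ N : ℕ, ∃ A ∈ auxG n, auxq (auxA A v) ≤ (1/2)^N * auxq v := by
    intro N
    induction N with
    | zero => exact ⟨1, one_mem _, by simp [auxA_one]⟩
    | succ N ih =>
      obtain ⟨A, hA, h⟩ := ih
      obtain ⟨B, hB, h'⟩ := aux_contract n hn (auxA A v) (auxA_ne _ _ hv)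
        (fun h => hc (auxCusp_of n v A hA h))
      refine ⟨B * A, mul_mem hB hA, ?_⟩
      rw [auxA_mul, pow_succ]
      linarith
  have hq : 0 ≤ auxq v := by unfold auxq; positivity
  obtain ⟨N, hN⟩ := exists_pow_lt_of_lt_one (show 0 < ε / (auxq v + 1) by positivity)
    (show (1/2:ℝ) < 1 by norm_num)
  obtain ⟨A, hA, h⟩ := key N
  refine ⟨A, hA, h.trans_lt ?_⟩
  rw [lt_div_iff₀ (by positivity)] at hN
  have : (0:ℝ) < (1/2)^N := by positivity
  linarith

lemma aux_closure (S : Set (Fin 2 → ℝ)) (u : Fin 2 → ℝ)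
    (h : ∀ ε > 0, ∃ w ∈ S, auxq (w - u) < ε) : u ∈ closure S := by
  rw [Metric.mem_closure_iff]
  intro ε hε
  obtain ⟨w, hw, hq⟩ := h (ε^2) (by positivity)
  refine ⟨w, hw, ?_⟩
  rw [dist_comm, dist_pi_lt_iff hε]
  simp only [auxq, Pi.sub_apply] at hq
  intro i
  rw [Real.dist_eq]
  apply abs_lt_of_sq_lt_sq _ hε.le
  fin_cases i <;> simp <;> nlinarith [sq_nonneg (w 0 - u 0), sq_nonneg (w 1 - u 1)]

/-- the orbit -/
def auxO (n : ℕ) (v : Fin 2 → ℝ) : Set (Fin 2 → ℝ) := {w | ∃ A ∈ auxG n, w = auxA A v}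

lemma auxA_cont (A : Matrix.SpecialLinearGroup (Fin 2) ℝ) : Continuous (auxA A) := by
  unfold auxA
  exact Continuous.matrix_mulVec continuous_const continuous_id

lemma auxO_inv (n : ℕ) (v u : Fin 2 → ℝ) (A : Matrix.SpecialLinearGroup (Fin 2) ℝ)
    (hA : A ∈ auxG n) (hu : u ∈ closure (auxO n v)) : auxA A u ∈ closure (auxO n v) := by
  refine map_mem_closure (auxA_cont A) hu ?_
  rintro w ⟨B, hB, rfl⟩
  exact ⟨A * B, mul_mem hA hB, by rw [auxA_mul]⟩

lemma aux_line (n : ℕ) (hn : 8 ≤ n) (v : Fin 2 → ℝ) (hv : v ≠ 0) (hc : ¬ auxCusp n v)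
    (k : ℤ) (t : ℝ) : t • auxE n k ∈ closure (auxO n v) := by
  apply aux_closure
  intro ε hε
  have hn' : (8:ℝ) ≤ n := by exact_mod_cast hn
  have hs : 0 < Real.sin (Real.pi / n) := by
    apply Real.sin_pos_of_pos_of_lt_pi (by positivity)
    apply div_lt_self Real.pi_pos; linarith
  obtain ⟨A, hA, h⟩ := aux_small n hn v hv hc (ε * Real.sin (Real.pi / n)^2) (by positivity)
  obtain ⟨B, hB, h'⟩ := aux_move n hn k (auxA A v) t
    (fun h => hc (auxCusp_of n v A hA (auxCusp_axis n k _ (auxA_ne _ _ hv) h)))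
  refine ⟨auxA (B * A) v, ⟨_, mul_mem hB hA, rfl⟩, ?_⟩
  rw [auxA_mul]
  refine h'.trans_lt ?_
  rw [div_lt_iff₀ (by positivity)]
  refine lt_of_le_of_lt ?_ h
  rw [← auxq_rot n (-k) (auxA A v), auxq]
  nlinarith [sq_nonneg (auxA (rotMat n ^ (-k)) (auxA A v) 0)]

lemma aux_near (z u : Fin 2 → ℝ) (hz : 0 < auxq z) :
    ∃ t : ℝ, auxq (t • z - u) = (z 0 * u 1 - z 1 * u 0)^2 / auxq z := by
  refine ⟨(z 0 * u 0 + z 1 * u 1) / auxq z, ?_⟩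
  rw [eq_div_iff hz.ne']
  have : ((z 0 * u 0 + z 1 * u 1) / auxq z) * auxq z = z 0 * u 0 + z 1 * u 1 := by
    field_simp
  set s := (z 0 * u 0 + z 1 * u 1) / auxq z
  simp only [auxq, Pi.sub_apply, Pi.smul_apply, smul_eq_mul] at *
  linear_combination (s * (z 0 ^ 2 + z 1 ^ 2) - (z 0 * u 0 + z 1 * u 1)) * this

lemma aux_dense (n : ℕ) (hn : 8 ≤ n) (v : Fin 2 → ℝ) (hv : v ≠ 0) (hc : ¬ auxCusp n v)
    (u : Fin 2 → ℝ) : u ∈ closure (auxO n v) := by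
  have hn' : (8:ℝ) ≤ n := by exact_mod_cast hn
  have hs : 0 < Real.sin (Real.pi / n) := by
    apply Real.sin_pos_of_pos_of_lt_pi (by positivity)
    apply div_lt_self Real.pi_pos; linarith
  have hl : ∀ k : ℤ, ∀ t : ℝ, ∀ A ∈ auxG n, t • auxA A (auxE n k) ∈ closure (auxO n v) := by
    intro k t A hA
    rw [← auxA_smul]
    exact auxO_inv n v _ A hA (aux_line n hn v hv hc k t)
  by_cases hu : u = 0
  · have := hl 0 0 1 (one_mem _)
    simpa [hu] using this
  by_cases hcu : auxCusp n u
  · obtain ⟨c, A, -, hA, rfl | rfl⟩ := hcu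
    · exact hl _ _ _ hA
    · exact hl _ _ _ hA
  rw [← closure_closure]
  apply aux_closure
  intro ε hε
  obtain ⟨A, hA, h⟩ := aux_small n hn u hu hcu (ε * Real.sin (Real.pi / n)) (by positivity)
  have hdet := auxA_det A⁻¹ (auxE n 0) (auxE n 1)
  have hbig : ∃ k : ℤ, Real.sin (Real.pi / n) ≤ auxq (auxA A⁻¹ (auxE n k)) := by
    by_contra! hcon
    have h0 := hcon 0
    have h1 := hcon 1
    have : auxE n 0 0 * auxE n 1 1 - auxE n 0 1 * auxE n 1 0 = Real.sin (Real.pi / n) := by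
      rw [auxE_zero, auxE_one]; simp
    rw [this] at hdet
    unfold auxq at h0 h1
    nlinarith [sq_nonneg (auxA A⁻¹ (auxE n 0) 0 - auxA A⁻¹ (auxE n 1) 1),
      sq_nonneg (auxA A⁻¹ (auxE n 0) 1 + auxA A⁻¹ (auxE n 1) 0)]
  obtain ⟨k, hk⟩ := hbig
  obtain ⟨t, ht⟩ := aux_near (auxA A⁻¹ (auxE n k)) u (hs.trans_le hk)
  refine ⟨_, hl k t A⁻¹ (inv_mem hA), ?_⟩
  rw [ht, div_lt_iff₀ (hs.trans_le hk)]
  have h2 := auxA_det A⁻¹ (auxE n k) (auxA A u)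
  rw [auxA_inv] at h2
  rw [h2]
  have hE : auxq (auxE n k) = 1 := by rw [auxE, auxq_rot]; simp [auxq]
  have h3 : (auxE n k 0 * auxA A u 1 - auxE n k 1 * auxA A u 0)^2 ≤ auxq (auxE n k) * auxq (auxA A u) := by
    unfold auxq
    nlinarith [sq_nonneg (auxE n k 0 * auxA A u 0 + auxE n k 1 * auxA A u 1)]
  rw [hE, one_mul] at h3
  nlinarith [mul_le_mul_of_nonneg_left hk hε.le]

/-- For even `n ≥ 8`, let `Γ_n ≤ SL(2,ℝ)` be generated by `r_n², s_n, r_n s_n r_n⁻¹` (the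
Veech group of the regular `n`-gon surface). If `v ∈ ℝ² \ {0}` has non-dense `Γ_n`-orbit under
the standard linear action on `ℝ²`, then `v` is a nonzero scalar multiple of a vector in
`Γ_n · (1,0)` or in `Γ_n · (cos(π/n), sin(π/n))`. -/
theorem non_dense_orbit_even (n : ℕ) (hn : 8 ≤ n) (heven : Even n) (v : Fin 2 → ℝ) (hv : v ≠ 0)
    (hnd : ¬ Dense {w : Fin 2 → ℝ |
      ∃ A ∈ Subgroup.closure {rotMat n ^ 2, shearMat n, rotMat n * shearMat n * (rotMat n)⁻¹},
      w = Matrix.mulVec (A : Matrix (Fin 2) (Fin 2) ℝ) v}) :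
    ∃ (c : ℝ) (A : Matrix.SpecialLinearGroup (Fin 2) ℝ), c ≠ 0 ∧
      A ∈ Subgroup.closure {rotMat n ^ 2, shearMat n, rotMat n * shearMat n * (rotMat n)⁻¹} ∧
      (v = c • Matrix.mulVec (A : Matrix (Fin 2) (Fin 2) ℝ) ![1, 0] ∨
        v = c • Matrix.mulVec (A : Matrix (Fin 2) (Fin 2) ℝ)
          ![Real.cos (Real.pi / n), Real.sin (Real.pi / n)]) := by
  by_contra hcon
  apply hnd
  intro u
  refine aux_dense n hn v hv ?_ u
  rintro ⟨c, A, hc, hA, h⟩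
  rw [auxE_zero, auxE_one] at h
  exact hcon ⟨c, A, hc, hA, h⟩
end
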